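/- Let n ≥ 1, let f : ℝⁿ → ℝ be convex and differentiable with L_f-Lipschitz gradient, let M > 0 and let φ : ℝⁿ → ℝ be M-weakly convex, and let λ > 0, τ > 0, α ∈ (0,1]. Let x, y ∈ ℝⁿ, set q := (1−α)·y + α·x, let x⁺ be a global minimizer over ℝⁿ of w ↦ τ·φ(w) + (1/2)‖w − (x − τ·λ·∇f(q))‖², and set y⁺ := (1−α)·y + α·x⁺. Then for every u ∈ ℝⁿ: φ(u) + λ·f(u) + λ·(1/α − 1)·f(y) + (1/(2τ))·‖u − x‖² ≥ φ(x⁺) + (λ/α)·f(y⁺) + (1/(2τ) − α·λ·L_f/2)·‖x⁺ − x‖² + (1/(2τ) − M/2)·‖x⁺ − u‖². -/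

import Mathlib

section SmoothConvex

variable {E : Type*} [NormedAddCommGroup E] [InnerProductSpace ℝ E]

theorem hasDerivAt_comp_line_of_differentiable [CompleteSpace E] {f : E → ℝ}
    (hf : Differentiable ℝ f) (a d : E) (t : ℝ) :
    HasDerivAt (fun s : ℝ => f (a + s • d)) (inner ℝ (gradient f (a + t • d)) d) t := by
  have hline : HasDerivAt (fun s : ℝ => a + s • d) d t := by
    simpa using ((hasDerivAt_id t).smul_const d).const_add a
  have h := (hf (a + t • d)).hasGradientAt.hasFDerivAt.comp_hasDerivAt t hline
  simpa [Function.comp_def] using h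

/-- A differentiable convex function lies above its tangent planes. -/
theorem ConvexOn.add_inner_gradient_le [CompleteSpace E] {f : E → ℝ}
    (hfc : ConvexOn ℝ Set.univ f) (hf : Differentiable ℝ f) (a b : E) :
    f a + inner ℝ (gradient f a) (b - a) ≤ f b := by
  have hd := hasDerivAt_comp_line_of_differentiable hf a (b - a) 0
  have hc : ConvexOn ℝ Set.univ (fun s : ℝ => f (a + s • (b - a))) := by
    have h := hfc.comp_affineMap (AffineMap.lineMap a b : ℝ →ᵃ[ℝ] E)
    simpa [Function.comp_def, AffineMap.lineMap_apply, add_comm] using h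
  have h := hc.le_slope_of_hasDerivAt (Set.mem_univ 0) (Set.mem_univ 1) one_pos hd
  simp only [slope_def_field, zero_smul, one_smul, add_zero, add_sub_cancel, sub_zero, div_one] at h
  linarith

/-- The descent lemma for functions with Lipschitz gradient. -/
theorem le_add_inner_gradient_add_sq_of_lipschitz [CompleteSpace E] {f : E → ℝ} {L : ℝ}
    (hf : Differentiable ℝ f)
    (hLip : ∀ a b, ‖gradient f a - gradient f b‖ ≤ L * ‖a - b‖) (a d : E) :
    f (a + d) ≤ f a + inner ℝ (gradient f a) d + L / 2 * ‖d‖ ^ 2 := by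
  have hder (t : ℝ) : HasDerivAt
      (fun s : ℝ => f (a + s • d) - s * inner ℝ (gradient f a) d - L / 2 * ‖d‖ ^ 2 * s ^ 2)
      (inner ℝ (gradient f (a + t • d)) d - inner ℝ (gradient f a) d - L * ‖d‖ ^ 2 * t) t := by
    refine (((hasDerivAt_comp_line_of_differentiable hf a d t).sub
      ((hasDerivAt_id t).mul_const _)).sub
      ((hasDerivAt_pow 2 t).const_mul (L / 2 * ‖d‖ ^ 2))).congr_deriv ?_
    simp
    ring
  have hanti := antitoneOn_of_deriv_nonpos (convex_Icc (0 : ℝ) 1)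
    (fun t _ => (hder t).continuousAt.continuousWithinAt)
    (fun t _ => (hder t).differentiableAt.differentiableWithinAt) (fun t ht => by
      rw [interior_Icc] at ht
      rw [(hder t).deriv, ← inner_sub_left]
      have h1 := real_inner_le_norm (gradient f (a + t • d) - gradient f a) d
      have h2 := hLip (a + t • d) a
      rw [add_sub_cancel_left, norm_smul, Real.norm_of_nonneg ht.1.le] at h2
      nlinarith [mul_le_mul_of_nonneg_right h2 (norm_nonneg d)])
  have h := hanti (Set.left_mem_Icc.2 zero_le_one) (Set.right_mem_Icc.2 zero_le_one) zero_le_one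
  simp only [zero_smul, one_smul, add_zero] at h
  linarith

/-- Variational inequality satisfied by a proximal point of a weakly convex function. -/
theorem IsMinOn.prox_variational_inequality {φ : E → ℝ} {M τ : ℝ} (hτ : 0 < τ)
    (hφ : ConvexOn ℝ Set.univ (fun w => φ w + (M / 2) * ‖w‖ ^ 2)) {c p : E}
    (hp : IsMinOn (fun w => τ * φ w + (1 / 2) * ‖w - c‖ ^ 2) Set.univ p) (u : E) :
    0 ≤ τ * (φ u - φ p) + τ * (M / 2) * ‖u - p‖ ^ 2 + inner ℝ (u - p) (p - c) := by
  have key (t : ℝ) (ht : t ∈ Set.Ioo (0 : ℝ) 1) :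
      0 ≤ τ * (φ u - φ p) + τ * (M / 2) * (1 - t) * ‖u - p‖ ^ 2 + inner ℝ (u - p) (p - c)
        + t / 2 * ‖u - p‖ ^ 2 := by
    obtain ⟨ht0, ht1⟩ := ht
    have hmin := isMinOn_iff.1 hp ((1 - t) • p + t • u) (Set.mem_univ _)
    have hconv := hφ.2 (Set.mem_univ p) (Set.mem_univ u) (sub_nonneg.2 ht1.le) ht0.le
      (sub_add_cancel 1 t)
    simp only [smul_eq_mul] at hconv
    have e1 : ‖(1 - t) • p + t • u‖ ^ 2
        = (1 - t) * ‖p‖ ^ 2 + t * ‖u‖ ^ 2 - t * (1 - t) * ‖u - p‖ ^ 2 := by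
      rw [norm_add_sq_real, norm_sub_sq_real, norm_smul, norm_smul, mul_pow, mul_pow,
        Real.norm_eq_abs, Real.norm_eq_abs, sq_abs, sq_abs, inner_smul_left, inner_smul_right,
        real_inner_comm]
      simp
      ring
    have e2 : ‖(1 - t) • p + t • u - c‖ ^ 2
        = ‖p - c‖ ^ 2 + 2 * t * inner ℝ (u - p) (p - c) + t ^ 2 * ‖u - p‖ ^ 2 := by
      have h : (1 - t) • p + t • u - c = (p - c) + t • (u - p) := by module
      rw [h, norm_add_sq_real, norm_smul, mul_pow, Real.norm_eq_abs, sq_abs, inner_smul_right,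
        real_inner_comm]
      ring
    rw [e1] at hconv
    rw [e2] at hmin
    refine nonneg_of_mul_nonneg_right ?_ ht0
    nlinarith [mul_le_mul_of_nonneg_left hconv hτ.le]
  have hcont : Continuous fun t : ℝ => τ * (φ u - φ p) + τ * (M / 2) * (1 - t) * ‖u - p‖ ^ 2
      + inner ℝ (u - p) (p - c) + t / 2 * ‖u - p‖ ^ 2 := by fun_prop
  have hlim := (hcont.tendsto 0).mono_left (nhdsWithin_le_nhds (s := Set.Ioi 0))
  have h := ge_of_tendsto hlim
    (Filter.eventually_of_mem (Ioo_mem_nhdsGT one_pos) key)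
  simpa using h

end SmoothConvex

/-- Key per-iteration inequality for one step of the relaxed proximal
gradient (αPGD) algorithm. -/
theorem alphaPGD_one_step_key_inequality
    (n : ℕ) (hn : 1 ≤ n)
    (f φ : EuclideanSpace ℝ (Fin n) → ℝ) (Lf M lam τ α : ℝ)
    (hfc : ConvexOn ℝ Set.univ f)
    (hf : Differentiable ℝ f)
    (hLip : ∀ a b, ‖gradient f a - gradient f b‖ ≤ Lf * ‖a - b‖)
    (hM : 0 < M)
    (hφ : ConvexOn ℝ Set.univ (fun w => φ w + (M / 2) * ‖w‖ ^ 2))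
    (hlam : 0 < lam) (hτ : 0 < τ) (hα0 : 0 < α) (hα1 : α ≤ 1)
    (x y : EuclideanSpace ℝ (Fin n))
    (xp : EuclideanSpace ℝ (Fin n))
    (hxp : IsMinOn
      (fun w => τ * φ w +
        (1 / 2) * ‖w - (x - (τ * lam) • gradient f ((1 - α) • y + α • x))‖ ^ 2)
      Set.univ xp) :
    ∀ u : EuclideanSpace ℝ (Fin n),
      φ u + lam * f u + lam * (1 / α - 1) * f y + (1 / (2 * τ)) * ‖u - x‖ ^ 2 ≥
        φ xp + (lam / α) * f ((1 - α) • y + α • xp) +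
          (1 / (2 * τ) - α * lam * Lf / 2) * ‖xp - x‖ ^ 2 +
          (1 / (2 * τ) - M / 2) * ‖xp - u‖ ^ 2 := by
  intro u
  set q := (1 - α) • y + α • x with hq
  set g := gradient f q with hg
  have hprox := hxp.prox_variational_inequality hτ hφ u
  have hinner : inner ℝ (u - xp) (xp - (x - (τ * lam) • g))
      = (‖u - x‖ ^ 2 - ‖xp - u‖ ^ 2 - ‖xp - x‖ ^ 2) / 2 + τ * lam * inner ℝ g (u - xp) := by
    have h1 : xp - (x - (τ * lam) • g) = (xp - x) + (τ * lam) • g := by module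
    have h2 : u - x = (u - xp) + (xp - x) := by module
    rw [h1, inner_add_right, inner_smul_right, h2, norm_add_sq_real, norm_sub_rev xp u,
      real_inner_comm g]
    ring
  rw [hinner, norm_sub_rev u xp] at hprox
  have hdesc := le_add_inner_gradient_add_sq_of_lipschitz hf hLip q (α • (xp - x))
  have hyp : q + α • (xp - x) = (1 - α) • y + α • xp := by rw [hq]; module
  rw [hyp, ← hg, inner_smul_right, norm_smul, mul_pow, Real.norm_of_nonneg hα0.le] at hdesc
  have hu := hfc.add_inner_gradient_le hf q u
  have hy := hfc.add_inner_gradient_le hf q y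
  have hcomb : α * inner ℝ g (u - q) + (1 - α) * inner ℝ g (y - q)
      = α * inner ℝ g (u - xp) + α * inner ℝ g (xp - x) := by
    simp only [← inner_smul_right, ← inner_add_right]
    congr 1
    rw [hq]
    module
  have hsmooth : f ((1 - α) • y + α • xp) + α * inner ℝ g (u - xp)
      - Lf / 2 * (α ^ 2 * ‖xp - x‖ ^ 2) ≤ α * f u + (1 - α) * f y := by
    linarith [mul_le_mul_of_nonneg_left hu hα0.le,
      mul_le_mul_of_nonneg_left hy (sub_nonneg.2 hα1)]
  have hA := mul_le_mul_of_nonneg_left hsmooth (mul_pos hτ hlam).le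
  have hB := mul_nonneg hα0.le hprox
  field_simp
  linarith
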